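/- For every r > 0, the functions 𝔞(t,·) satisfy ∫_r^∞ ‖∇𝔞(t,·)‖²_{L²} dt ≤ (1/2)·π_0·𝔞(2r, 0), where π_0 = 1/ω_0. -/

import Mathlib

open Filter MeasureTheory Topology

/-- `(P^n)_{k,j}` for the balanced walk on `ℤ` with transition probabilities
`P_{k,k-1} = P_{k,k+1} = ω k`, `P_{k,k} = 1 - 2 ω k`. -/
noncomputable def Ppow (ω : ℤ → ℝ) : ℕ → ℤ → ℤ → ℝ
  | 0, k, j => if k = j then 1 else 0
  | n + 1, k, j =>
      ω k * Ppow ω n (k - 1) j + (1 - 2 * ω k) * Ppow ω n k j + ω k * Ppow ω n (k + 1) j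

/-- The continuous-time semigroup `(𝒫^t)_{k,j} = e^{-t} Σ_n t^n/n! (P^n)_{k,j}`. -/
noncomputable def calP (ω : ℤ → ℝ) (t : ℝ) (k j : ℤ) : ℝ :=
  Real.exp (-t) * ∑' n : ℕ, t ^ n / (Nat.factorial n) * Ppow ω n k j

namespace BalancedWalk

lemma Ppow_nonneg {ω : ℤ → ℝ} (hω : ∀ k : ℤ, 0 < ω k ∧ ω k ≤ 1 / 2) (n : ℕ) (k j : ℤ) :
    0 ≤ Ppow ω n k j := by
  induction n generalizing k with
  | zero => simp only [Ppow]; split_ifs <;> norm_num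
  | succ n ih =>
    obtain ⟨h₀, h₁⟩ := hω k
    have := mul_nonneg h₀.le (ih (k - 1))
    have := mul_nonneg h₀.le (ih (k + 1))
    have := mul_nonneg (by linarith : 0 ≤ 1 - 2 * ω k) (ih k)
    simp only [Ppow]
    linarith

lemma Ppow_le_one {ω : ℤ → ℝ} (hω : ∀ k : ℤ, 0 < ω k ∧ ω k ≤ 1 / 2) (n : ℕ) (k j : ℤ) :
    Ppow ω n k j ≤ 1 := by
  induction n generalizing k with
  | zero => simp only [Ppow]; split_ifs <;> norm_num
  | succ n ih =>
    obtain ⟨h₀, h₁⟩ := hω k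
    have := mul_le_mul_of_nonneg_left (ih (k - 1)) h₀.le
    have := mul_le_mul_of_nonneg_left (ih (k + 1)) h₀.le
    have := mul_le_mul_of_nonneg_left (ih k) (by linarith : 0 ≤ 1 - 2 * ω k)
    simp only [Ppow]
    linarith

lemma abs_Ppow_le_one {ω : ℤ → ℝ} (hω : ∀ k : ℤ, 0 < ω k ∧ ω k ≤ 1 / 2) (n : ℕ) (k j : ℤ) :
    |Ppow ω n k j| ≤ 1 := by
  rw [abs_of_nonneg (Ppow_nonneg hω n k j)]
  exact Ppow_le_one hω n k j

lemma support_Ppow_finite (ω : ℤ → ℝ) (n : ℕ) (j : ℤ) :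
    (Function.support fun k => Ppow ω n k j).Finite := by
  induction n with
  | zero =>
    refine (Set.finite_singleton j).subset fun k hk => ?_
    by_contra h
    simp_all [Ppow]
  | succ n ih =>
    have h₁ := ih.preimage ((sub_left_injective (b := (1 : ℤ))).injOn)
    have h₂ := ih.preimage ((add_left_injective (1 : ℤ)).injOn)
    refine ((h₁.union ih).union h₂).subset fun k hk => ?_
    by_contra h
    simp_all [Ppow]

/-- Summation by parts on `ℤ` for finitely supported functions. -/
lemma tsum_gradient_mul_gradient {f g : ℤ → ℝ} (hf : f.support.Finite) :
    ∑' k, (f (k + 1) - f k) * (g (k + 1) - g k)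
      = ∑' k, f k * (2 * g k - g (k - 1) - g (k + 1)) := by
  have hs : ∀ h : ℤ → ℝ, Summable fun k => f k * h k := fun h =>
    summable_of_hasFiniteSupport (hf.subset (Function.support_mul_subset_left _ _))
  have shift : ∀ h : ℤ → ℝ, ∑' k, f (k + 1) * h (k + 1) = ∑' k, f k * h k := fun h =>
    (Equiv.addRight (1 : ℤ)).tsum_eq fun k => f k * h k
  have hs' : ∀ h : ℤ → ℝ, Summable fun k => f (k + 1) * h (k + 1) := fun h =>
    (Equiv.addRight (1 : ℤ)).summable_iff (f := fun k => f k * h k) |>.2 (hs h)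
  have h₁ := shift fun k => g k - g (k - 1)
  have h₂ := hs' fun k => g k - g (k - 1)
  simp only [add_sub_cancel_right] at h₁ h₂
  calc
    _ = ∑' k, (f (k + 1) * (g (k + 1) - g k) - f k * (g (k + 1) - g k)) := by
      congr 1; ext k; ring
    _ = ∑' k, f k * (g k - g (k - 1)) - ∑' k, f k * (g (k + 1) - g k) := by
      rw [h₂.tsum_sub (hs _), h₁]
    _ = _ := by
      rw [← (hs _).tsum_sub (hs _)]
      congr 1; ext k; ring

lemma tsum_gradient_Ppow_eq_sub {ω : ℤ → ℝ} (hω : ∀ k : ℤ, 0 < ω k ∧ ω k ≤ 1 / 2)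
    (n m : ℕ) (j : ℤ) :
    ∑' k, (Ppow ω n (k + 1) j - Ppow ω n k j) * (Ppow ω m (k + 1) j - Ppow ω m k j)
      = ∑' k, Ppow ω n k j * (Ppow ω m k j / ω k)
        - ∑' k, Ppow ω n k j * (Ppow ω (m + 1) k j / ω k) := by
  have hf := support_Ppow_finite ω n j
  have hs : ∀ h : ℤ → ℝ, Summable fun k => Ppow ω n k j * h k := fun h =>
    summable_of_hasFiniteSupport (hf.subset (Function.support_mul_subset_left _ _))
  rw [tsum_gradient_mul_gradient (f := fun k => Ppow ω n k j) (g := fun k => Ppow ω m k j) hf,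
    ← (hs _).tsum_sub (hs _)]
  congr 1; ext k
  have := (hω k).1.ne'
  simp only [Ppow]
  field_simp
  ring

/-- Reversibility of the walk with respect to `π k = 1 / ω k`. -/
lemma tsum_Ppow_mul_Ppow_div {ω : ℤ → ℝ} (hω : ∀ k : ℤ, 0 < ω k ∧ ω k ≤ 1 / 2)
    (n m : ℕ) (j : ℤ) :
    ∑' k, Ppow ω n k j * (Ppow ω m k j / ω k) = Ppow ω (n + m) j j / ω j := by
  induction n generalizing m with
  | zero =>
    rw [tsum_eq_single j]
    · simp [Ppow]
    · intro k hk; simp [Ppow, hk]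
  | succ n ih =>
    have h₁ := tsum_gradient_Ppow_eq_sub hω n m j
    have h₂ := tsum_gradient_Ppow_eq_sub hω m n j
    have symm : ∀ a b : ℕ, ∑' k, Ppow ω a k j * (Ppow ω b k j / ω k)
        = ∑' k, Ppow ω b k j * (Ppow ω a k j / ω k) := fun a b => by
      congr 1; ext k; ring
    have hg : ∑' k, (Ppow ω n (k + 1) j - Ppow ω n k j) * (Ppow ω m (k + 1) j - Ppow ω m k j)
        = ∑' k, (Ppow ω m (k + 1) j - Ppow ω m k j) * (Ppow ω n (k + 1) j - Ppow ω n k j) := by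
      congr 1; ext k; ring
    have h₃ := ih (m + 1)
    rw [symm m n, symm m (n + 1)] at h₂
    rw [show n + 1 + m = n + (m + 1) by ring, ← h₃]
    linarith

lemma tsum_gradient_Ppow {ω : ℤ → ℝ} (hω : ∀ k : ℤ, 0 < ω k ∧ ω k ≤ 1 / 2)
    (n m : ℕ) (j : ℤ) :
    ∑' k, (Ppow ω n (k + 1) j - Ppow ω n k j) * (Ppow ω m (k + 1) j - Ppow ω m k j)
      = (Ppow ω (n + m) j j - Ppow ω (n + m + 1) j j) / ω j := by
  rw [tsum_gradient_Ppow_eq_sub hω, tsum_Ppow_mul_Ppow_div hω, tsum_Ppow_mul_Ppow_div hω, sub_div,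
    add_assoc]

lemma support_gradient_Ppow_finite (ω : ℤ → ℝ) (n : ℕ) (j : ℤ) :
    (Function.support fun k => Ppow ω n (k + 1) j - Ppow ω n k j).Finite := by
  have h := support_Ppow_finite ω n j
  refine ((h.preimage ((add_left_injective (1 : ℤ)).injOn)).union h).subset fun k hk => ?_
  by_contra h
  simp_all

lemma summable_gradient_mul (ω : ℤ → ℝ) (n : ℕ) (j : ℤ) (h : ℤ → ℝ) :
    Summable fun k => (Ppow ω n (k + 1) j - Ppow ω n k j) * h k :=
  summable_of_hasFiniteSupport ((support_gradient_Ppow_finite ω n j).subset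
    (Function.support_mul_subset_left _ _))

lemma tsum_abs_gradient_Ppow_le {ω : ℤ → ℝ} (hω : ∀ k : ℤ, 0 < ω k ∧ ω k ≤ 1 / 2)
    (n m : ℕ) (j : ℤ) :
    ∑' k, |(Ppow ω n (k + 1) j - Ppow ω n k j) * (Ppow ω m (k + 1) j - Ppow ω m k j)|
      ≤ 1 / ω j := by
  set d : ℕ → ℤ → ℝ := fun n k => Ppow ω n (k + 1) j - Ppow ω n k j with hd
  have hs : ∀ a b, Summable fun k => d a k * d b k := fun a b => summable_gradient_mul ω a j _
  have hle : ∀ a, ∑' k, d a k * d a k ≤ 1 / ω j := fun a => by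
    rw [tsum_gradient_Ppow hω]
    have := (hω j).1
    gcongr
    linarith [Ppow_le_one hω (a + a) j j, Ppow_nonneg hω (a + a + 1) j j]
  calc
    ∑' k, |d n k * d m k| ≤ ∑' k, (1 / 2 * (d n k * d n k) + 1 / 2 * (d m k * d m k)) := by
      refine (hs n m).abs.tsum_le_tsum (fun k => ?_)
        (((hs n n).mul_left _).add ((hs m m).mul_left _))
      rw [abs_le]
      constructor <;> nlinarith [sq_nonneg (d n k + d m k), sq_nonneg (d n k - d m k)]
    _ = 1 / 2 * ∑' k, d n k * d n k + 1 / 2 * ∑' k, d m k * d m k := by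
      rw [((hs n n).mul_left _).tsum_add ((hs m m).mul_left _), tsum_mul_left, tsum_mul_left]
    _ ≤ 1 / ω j := by linarith [hle n, hle m]

lemma summable_pow_div_factorial_mul {a : ℕ → ℝ} {C : ℝ} (ha : ∀ n, |a n| ≤ C) (t : ℝ) :
    Summable fun n : ℕ => t ^ n / n.factorial * a n := by
  refine Summable.of_norm_bounded ((Real.summable_pow_div_factorial |t|).mul_right C) fun n => ?_
  rw [Real.norm_eq_abs, abs_mul, abs_div, abs_pow, Nat.abs_cast]
  gcongr
  exact ha n

lemma hasDerivAt_tsum_pow_div_factorial {a : ℕ → ℝ} {C : ℝ} (ha : ∀ n, |a n| ≤ C) (t : ℝ) :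
    HasDerivAt (fun s : ℝ => ∑' n : ℕ, s ^ n / n.factorial * a n)
      (∑' n : ℕ, t ^ n / n.factorial * a (n + 1)) t := by
  have hfac : ∀ (s : ℝ) (n : ℕ),
      ((n + 1 : ℕ) : ℝ) * s ^ n / (n + 1).factorial = s ^ n / n.factorial := fun s n => by
    rw [Nat.factorial_succ]
    have : ((n + 1 : ℕ) : ℝ) ≠ 0 := by positivity
    push_cast at this ⊢
    field_simp
  have key := hasDerivAt_tsum_of_isPreconnected (t := Metric.ball (0 : ℝ) (|t| + 1))
    (u := fun n : ℕ => (n : ℝ) * (|t| + 1) ^ (n - 1) / n.factorial * C)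
    (g := fun (n : ℕ) (s : ℝ) => s ^ n / n.factorial * a n)
    (g' := fun (n : ℕ) (s : ℝ) => n * s ^ (n - 1) / n.factorial * a n)
    (y₀ := 0) (y := t) ?_ Metric.isOpen_ball (convex_ball _ _).isPreconnected ?_ ?_ ?_
    (summable_pow_div_factorial_mul ha 0) ?_
  · refine key.congr_deriv ?_
    have hs : Summable fun n : ℕ => (n : ℝ) * t ^ (n - 1) / n.factorial * a n := by
      rw [← summable_nat_add_iff 1]
      simp only [add_tsub_cancel_right, hfac]
      exact summable_pow_div_factorial_mul (fun n => ha (n + 1)) t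
    rw [hs.tsum_eq_zero_add]
    simp only [add_tsub_cancel_right, hfac]
    simp
  · rw [← summable_nat_add_iff 1]
    simp only [add_tsub_cancel_right, hfac]
    exact (Real.summable_pow_div_factorial _).mul_right C
  · intro n s _
    exact ((hasDerivAt_pow n s).div_const _).mul_const _
  · intro n s hs
    have hs' : |s| ≤ |t| + 1 := by simpa using (mem_ball_zero_iff.1 hs).le
    rw [Real.norm_eq_abs, abs_mul, abs_div, abs_mul, abs_pow, Nat.abs_cast, Nat.abs_cast]
    gcongr
    exact ha n
  · simp; positivity
  · simp

lemma tsum_prod_pow_div_factorial {a : ℕ → ℝ} {C : ℝ} (ha : ∀ n, |a n| ≤ C) (t : ℝ) :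
    ∑' p : ℕ × ℕ, t ^ p.1 / p.1.factorial * (t ^ p.2 / p.2.factorial) * a (p.1 + p.2)
      = ∑' n : ℕ, (2 * t) ^ n / n.factorial * a n := by
  have hs : Summable fun p : ℕ × ℕ =>
      t ^ p.1 / p.1.factorial * (t ^ p.2 / p.2.factorial) * a (p.1 + p.2) := by
    have hc := (Real.summable_pow_div_factorial |t|)
    refine Summable.of_norm_bounded ((hc.mul_of_nonneg hc (fun n => by positivity)
      (fun n => by positivity)).mul_right C) fun p => ?_
    simp only [Real.norm_eq_abs, abs_mul, abs_div, abs_pow, Nat.abs_cast]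
    gcongr
    exact ha _
  rw [← Finset.HasAntidiagonal.sigmaAntidiagonalEquivProd.tsum_eq]
  refine (Summable.tsum_sigma' (fun n => (hasSum_fintype _).summable)
    (Finset.HasAntidiagonal.sigmaAntidiagonalEquivProd.summable_iff.2 hs)).trans ?_
  congr 1; ext n
  rw [tsum_fintype, two_mul, (Commute.all t t).add_pow', Finset.sum_div, Finset.sum_mul,
    ← Finset.sum_coe_sort (Finset.HasAntidiagonal.antidiagonal n)]
  refine Finset.sum_congr rfl fun p _ => ?_
  obtain ⟨⟨i, k⟩, hp⟩ := p
  obtain rfl : i + k = n := Finset.HasAntidiagonal.mem_antidiagonal.1 hp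
  simp only [Function.comp_apply, Finset.HasAntidiagonal.sigmaAntidiagonalEquivProd_apply,
    nsmul_eq_mul]
  rw [← Nat.add_choose_mul_factorial_mul_factorial i k, Nat.choose_symm_add]
  have : ((i + k).choose k : ℝ) ≠ 0 := by
    exact_mod_cast (Nat.choose_pos (Nat.le_add_left k i)).ne'
  push_cast
  field_simp

lemma tsum_gradient_calP_sq {ω : ℤ → ℝ} (hω : ∀ k : ℤ, 0 < ω k ∧ ω k ≤ 1 / 2)
    (t : ℝ) (j : ℤ) :
    ∑' k : ℤ, (calP ω t (k + 1) j - calP ω t k j) ^ 2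
      = Real.exp (-(2 * t)) * ∑' n : ℕ, (2 * t) ^ n / n.factorial *
          ((Ppow ω n j j - Ppow ω (n + 1) j j) / ω j) := by
  set c : ℕ → ℝ := fun n => t ^ n / n.factorial with hc
  set d : ℕ → ℤ → ℝ := fun n k => Ppow ω n (k + 1) j - Ppow ω n k j with hd
  have hd2 : ∀ n k, |d n k| ≤ 1 := fun n k => by
    rw [abs_le]
    constructor <;> linarith [Ppow_nonneg hω n k j, Ppow_nonneg hω n (k + 1) j,
      Ppow_le_one hω n k j, Ppow_le_one hω n (k + 1) j]
  have hcd : ∀ k, Summable fun n => c n * d n k := fun k =>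
    summable_pow_div_factorial_mul (fun n => hd2 n k) t
  have hcs : Summable fun n => |c n| := (Real.summable_pow_div_factorial t).abs
  have hgrad : ∀ k, calP ω t (k + 1) j - calP ω t k j
      = Real.exp (-t) * ∑' n, c n * d n k := fun k => by
    rw [calP, calP, ← mul_sub, ← Summable.tsum_sub
      (summable_pow_div_factorial_mul (fun n => abs_Ppow_le_one hω n _ j) t)
      (summable_pow_div_factorial_mul (fun n => abs_Ppow_le_one hω n _ j) t)]
    congr 2; ext n; simp only [hc, hd]; ring
  have hsq : ∀ k, (calP ω t (k + 1) j - calP ω t k j) ^ 2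
      = Real.exp (-(2 * t)) * ∑' p : ℕ × ℕ, c p.1 * c p.2 * (d p.1 k * d p.2 k) := fun k => by
    rw [hgrad, mul_pow, ← Real.exp_nat_mul, sq (∑' n, _),
      tsum_mul_tsum_of_summable_norm (hcd k).norm (hcd k).norm]
    congr 1
    · congr 1; push_cast; ring
    · congr 1; ext p; ring
  have hsum : Summable (Function.uncurry fun (p : ℕ × ℕ) (k : ℤ) =>
      c p.1 * c p.2 * (d p.1 k * d p.2 k)) := by
    rw [← summable_abs_iff, summable_prod_of_nonneg fun _ => abs_nonneg _]
    have hk : ∀ p : ℕ × ℕ, Summable fun k => d p.1 k * d p.2 k := fun p =>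
      summable_gradient_mul ω p.1 j _
    refine ⟨fun p => ((hk p).mul_left (c p.1 * c p.2)).abs, ?_⟩
    refine Summable.of_nonneg_of_le (fun p => tsum_nonneg fun k => abs_nonneg _) (fun p => ?_)
      ((hcs.mul_of_nonneg hcs (fun _ => abs_nonneg _) fun _ => abs_nonneg _).mul_right (1 / ω j))
    simp only [Function.uncurry, abs_mul (c p.1 * c p.2)]
    rw [tsum_mul_left, abs_mul (c p.1)]
    exact mul_le_mul_of_nonneg_left (tsum_abs_gradient_Ppow_le hω p.1 p.2 j) (by positivity)
  have hpos := (hω j).1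
  have ha : ∀ n, |(Ppow ω n j j - Ppow ω (n + 1) j j) / ω j| ≤ 1 / ω j := fun n => by
    rw [abs_div, abs_of_pos hpos]
    gcongr
    rw [abs_le]
    constructor <;> linarith [Ppow_nonneg hω n j j, Ppow_nonneg hω (n + 1) j j,
      Ppow_le_one hω n j j, Ppow_le_one hω (n + 1) j j]
  simp only [hsq]
  rw [tsum_mul_left, ← tsum_prod_pow_div_factorial ha, hsum.tsum_comm]
  congr 2; ext p
  rw [tsum_mul_left, tsum_gradient_Ppow hω]

lemma calP_nonneg {ω : ℤ → ℝ} (hω : ∀ k : ℤ, 0 < ω k ∧ ω k ≤ 1 / 2) {t : ℝ} (ht : 0 ≤ t)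
    (k j : ℤ) : 0 ≤ calP ω t k j :=
  mul_nonneg (Real.exp_pos _).le
    (tsum_nonneg fun n => mul_nonneg (by positivity) (Ppow_nonneg hω n k j))

/-- The Kolmogorov equation on the diagonal, read as energy dissipation. -/
lemma hasDerivAt_calP_two_mul {ω : ℤ → ℝ} (hω : ∀ k : ℤ, 0 < ω k ∧ ω k ≤ 1 / 2)
    (t : ℝ) (j : ℤ) :
    HasDerivAt (fun s => -((1 / 2) * (1 / ω j) * calP ω (2 * s) j j))
      (∑' k : ℤ, (calP ω t (k + 1) j - calP ω t k j) ^ 2) t := by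
  have hb := fun n => abs_Ppow_le_one hω n j j
  have h₁ := (hasDerivAt_id' (2 * t)).neg.exp.mul (hasDerivAt_tsum_pow_div_factorial hb (2 * t))
  have h₂ := h₁.comp t ((hasDerivAt_id' t).const_mul 2)
  have h₃ := (h₂.const_mul ((1 / 2) * (1 / ω j))).neg
  refine h₃.congr_deriv ?_
  have hsub : ∑' n : ℕ, (2 * t) ^ n / n.factorial * ((Ppow ω n j j - Ppow ω (n + 1) j j) / ω j)
      = (∑' n : ℕ, (2 * t) ^ n / n.factorial * Ppow ω n j j
        - ∑' n : ℕ, (2 * t) ^ n / n.factorial * Ppow ω (n + 1) j j) / ω j := by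
    rw [← Summable.tsum_sub (summable_pow_div_factorial_mul hb _)
      (summable_pow_div_factorial_mul (fun n => hb (n + 1)) _), ← tsum_div_const]
    congr 1; ext n; ring
  rw [tsum_gradient_calP_sq hω, hsub]
  simp only [Pi.neg_apply]
  ring

end BalancedWalk

open BalancedWalk in
/-- **Lemma 1, first part.**  For `𝔞(t,k) = (𝒫^t)_{k,0}` one has
`∫_r^∞ ‖∇𝔞(t,·)‖²_{L²} dt ≤ (1/2) π₀ 𝔞(2r,0)` for every `r > 0`, where `π₀ = 1/ω₀`. -/
theorem integrated_gradient_bound_continuous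
    (ω : ℤ → ℝ) (hω : ∀ k : ℤ, 0 < ω k ∧ ω k ≤ 1 / 2)
    (r : ℝ) (hr : 0 < r) :
    (∫ t in Set.Ioi r, ∑' k : ℤ, (calP ω t (k + 1) 0 - calP ω t k 0) ^ 2)
      ≤ (1 / 2) * (1 / ω 0) * calP ω (2 * r) 0 0 := by
  set F : ℝ → ℝ := fun s => -((1 / 2) * (1 / ω 0) * calP ω (2 * s) 0 0) with hF
  have hderiv : ∀ t, HasDerivAt F (∑' k : ℤ, (calP ω t (k + 1) 0 - calP ω t k 0) ^ 2) t :=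
    fun t => hasDerivAt_calP_two_mul hω t 0
  have hnonneg : ∀ t, 0 ≤ ∑' k : ℤ, (calP ω t (k + 1) 0 - calP ω t k 0) ^ 2 :=
    fun t => tsum_nonneg fun k => sq_nonneg _
  have hmono : Monotone F := monotone_of_hasDerivAt_nonneg hderiv hnonneg
  have hFle : ∀ t, 0 ≤ t → F t ≤ 0 := fun t ht => by
    have := (hω 0).1
    have := calP_nonneg hω (mul_nonneg zero_le_two ht) 0 0
    simp only [hF]
    rw [neg_nonpos]
    positivity
  have hbdd : ∀ t, F t ≤ 0 := fun t =>
    (hmono (le_max_left t 0)).trans (hFle _ (le_max_right t 0))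
  have hlim := tendsto_atTop_ciSup hmono ⟨0, by rintro _ ⟨t, rfl⟩; exact hbdd t⟩
  rw [integral_Ioi_of_hasDerivAt_of_nonneg' (fun t _ => hderiv t) (fun t _ => hnonneg t) hlim]
  have hsup : ⨆ t, F t ≤ 0 := ciSup_le hbdd
  have hFr : F r = -((1 / 2) * (1 / ω 0) * calP ω (2 * r) 0 0) := rfl
  linarith
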